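/- For every subset S of {1, 2, 3, 4, 5, 6} there exist a full-dimensional integral polytope P ⊆ ℝ^8 and a polynomial p of degree 8 with rational coefficients and constant coefficient 1 such that i(P,t) = p(t) for every positive integer t, the coefficient of t^i in p is negative for every i ∈ S, and the coefficient of t^i in p is positive for every i ∈ {1, 2, …, 8} \ S. -/

import Mathlib

open scoped Pointwise BigOperators

/-- `P` is an integral polytope: the convex hull of finitely many points
with integer coordinates. -/
def IsIntegralPolytope {N : ℕ} (P : Set (Fin N → ℝ)) : Prop :=
  ∃ V : Finset (Fin N → ℝ),
    (∀ v ∈ V, ∀ i, ∃ z : ℤ, v i = (z : ℝ)) ∧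
    P = convexHull ℝ (V : Set (Fin N → ℝ))

/-- `latticeCount P t = i(P,t)`: the number of points of `ℤ^N` in the dilate `t • P`. -/
noncomputable def latticeCount {N : ℕ} (P : Set (Fin N → ℝ)) (t : ℕ) : ℕ :=
  Set.ncard {x : Fin N → ℝ | x ∈ (t : ℝ) • P ∧ ∀ i, ∃ z : ℤ, x i = (z : ℝ)}

/-- The functions `y : Fin n → ℕ` with `k + ∑ i, y i ≤ t`. -/
def boundedTuples (n k t : ℕ) : Finset (Fin n → ℕ) :=
  if k ≤ t then (Finset.range (t - k + 1)).biUnion fun s => Finset.piAntidiag Finset.univ s else ∅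

theorem mem_boundedTuples {n k t : ℕ} {y : Fin n → ℕ} :
    y ∈ boundedTuples n k t ↔ k + ∑ i, y i ≤ t := by
  unfold boundedTuples
  split_ifs with h
  · simp only [Finset.mem_biUnion, Finset.mem_range, Finset.mem_piAntidiag, Finset.mem_univ,
      implies_true, and_true, exists_eq_right']
    lia
  · simp only [Finset.notMem_empty, false_iff]
    lia

theorem card_piAntidiag_univ_fin (n s : ℕ) :
    (Finset.piAntidiag (Finset.univ : Finset (Fin n)) s).card = n.multichoose s := by
  rw [← Finset.map_sym_eq_piAntidiag, Finset.card_map, Finset.sym_univ, Finset.card_univ,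
    Sym.card_sym_fin_eq_multichoose]

/-- The value at `t` of the Ehrhart polynomial of a box point at height `k`. -/
def shiftedChoose (n t k : ℕ) : ℕ := if k ≤ t then (t - k + n).choose n else 0

theorem card_boundedTuples (n k t : ℕ) : (boundedTuples n k t).card = shiftedChoose n t k := by
  unfold boundedTuples shiftedChoose
  split_ifs with h
  · rw [Finset.card_biUnion]
    · simp_rw [card_piAntidiag_univ_fin]
      exact Nat.sum_range_multichoose _ _
    · intro a _ b _ hab
      refine Finset.disjoint_left.2 fun y hy hy' => hab ?_
      rw [Finset.mem_piAntidiag] at hy hy'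
      exact hy.1.symm.trans hy'.1
  · rfl

/-- The vertex of `residueSimplex` that is not a lattice basis vector. -/
def apex {n : ℕ} (m : ℕ) (a : Fin n → ℕ) : Fin (n + 1) → ℝ :=
  Fin.snoc (α := fun _ => ℝ) (fun i => -(a i : ℝ)) m

/-- The vertices of `residueSimplex` other than the origin. -/
def residueVertex {n : ℕ} (m : ℕ) (a : Fin n → ℕ) : Fin (n + 1) → Fin (n + 1) → ℝ :=
  Fin.lastCases (apex m a) fun i => Pi.single i.castSucc 1

/-- The simplex with vertices `0`, the first `n` basis vectors, and `(-a, m)`. -/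
noncomputable def residueSimplex {n : ℕ} (m : ℕ) (a : Fin n → ℕ) : Set (Fin (n + 1) → ℝ) :=
  convexHull ℝ ((insert 0 (Finset.univ.image (residueVertex m a)) : Finset (Fin (n + 1) → ℝ)) :
    Set (Fin (n + 1) → ℝ))

theorem isIntegralPolytope_residueSimplex {n : ℕ} (m : ℕ) (a : Fin n → ℕ) :
    IsIntegralPolytope (residueSimplex m a) := by
  refine ⟨_, fun v hv i => ?_, rfl⟩
  simp only [Finset.mem_insert, Finset.mem_image, Finset.mem_univ, true_and] at hv
  rcases hv with rfl | ⟨j, rfl⟩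
  · exact ⟨0, by simp⟩
  · cases j using Fin.lastCases with
    | last =>
      cases i using Fin.lastCases with
      | last => exact ⟨m, by simp [residueVertex, apex]⟩
      | cast i => exact ⟨-a i, by simp [residueVertex, apex]⟩
    | cast j =>
      by_cases h : i = j.castSucc
      · exact ⟨1, by simp [residueVertex, h]⟩
      · exact ⟨0, by simp [residueVertex, h]⟩

/-- Points of the `t`-th dilate of `residueSimplex`, by inequalities. -/
def residueHalfspaces {n : ℕ} (m : ℕ) (a : Fin n → ℕ) (t : ℝ) : Set (Fin (n + 1) → ℝ) :=
  {x | 0 ≤ x (Fin.last n) ∧ (∀ i : Fin n, 0 ≤ m * x i.castSucc + a i * x (Fin.last n)) ∧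
    ∑ i : Fin n, (m * x i.castSucc + a i * x (Fin.last n)) + x (Fin.last n) ≤ t * m}

theorem convex_residueHalfspaces {n : ℕ} (m : ℕ) (a : Fin n → ℕ) (t : ℝ) :
    Convex ℝ (residueHalfspaces m a t) := by
  rintro x ⟨hx, hx', hx''⟩ y ⟨hy, hy', hy''⟩ p q hp hq hpq
  have key : ∀ i : Fin n, m * (p • x + q • y) i.castSucc + a i * (p • x + q • y) (Fin.last n) =
      p * (m * x i.castSucc + a i * x (Fin.last n)) +
        q * (m * y i.castSucc + a i * y (Fin.last n)) := fun i => by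
    simp only [Pi.add_apply, Pi.smul_apply, smul_eq_mul]; ring
  refine ⟨?_, fun i => ?_, ?_⟩
  · simp only [Pi.add_apply, Pi.smul_apply, smul_eq_mul]; positivity
  · rw [key]
    have := hx' i
    have := hy' i
    positivity
  · simp_rw [key]
    rw [Finset.sum_add_distrib, ← Finset.mul_sum, ← Finset.mul_sum]
    simp only [Pi.add_apply, Pi.smul_apply, smul_eq_mul]
    have h1 := mul_le_mul_of_nonneg_left hx'' hp
    have h2 := mul_le_mul_of_nonneg_left hy'' hq
    have h3 : p * (t * m) + q * (t * m) = t * m := by rw [← add_mul, hpq, one_mul]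
    linarith

theorem residueSimplex_eq {n m : ℕ} (hm : 0 < m) (a : Fin n → ℕ) :
    residueSimplex m a = residueHalfspaces m a 1 := by
  have hm' : (0 : ℝ) < m := by exact_mod_cast hm
  apply Set.Subset.antisymm
  · refine convexHull_min (fun v hv => ?_) (convex_residueHalfspaces m a 1)
    simp only [Finset.coe_insert, Finset.coe_image, Finset.coe_univ, Set.image_univ,
      Set.mem_insert_iff, Set.mem_range] at hv
    rcases hv with rfl | ⟨j, rfl⟩
    · simp [residueHalfspaces]
    · cases j using Fin.lastCases with
      | last =>
        simp only [residueHalfspaces, residueVertex, apex, Fin.lastCases_last, Fin.snoc_last,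
          Fin.snoc_castSucc, Set.mem_ofPred_eq]
        have : ∀ i, (m : ℝ) * -(a i : ℝ) + a i * m = 0 := fun i => by ring
        exact ⟨hm'.le, fun i => (this i).ge, by simp only [this]; simp⟩
      | cast j =>
        simp only [residueHalfspaces, residueVertex, Fin.lastCases_castSucc, Set.mem_ofPred_eq]
        refine ⟨?_, fun i => ?_, ?_⟩
        · simp
        · by_cases h : i = j <;> simp [h]
        · simp [Pi.single_apply, (Fin.castSucc_lt_last j).ne']
  · rintro x ⟨hx, hx', hx''⟩
    set b : Fin (n + 1) → ℝ := Fin.snoc (α := fun _ => ℝ)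
      (fun i => (m * x i.castSucc + a i * x (Fin.last n)) / m) (x (Fin.last n) / m) with hb
    have hb0 : ∀ j, 0 ≤ b j := fun j => by
      cases j using Fin.lastCases with
      | last => simp only [hb, Fin.snoc_last]; positivity
      | cast j => simp only [hb, Fin.snoc_castSucc]; exact div_nonneg (hx' j) hm'.le
    have hb1 : ∑ j, b j ≤ 1 := by
      rw [Fin.sum_univ_castSucc]
      simp only [hb, Fin.snoc_last, Fin.snoc_castSucc]
      rw [← Finset.sum_div, ← add_div, div_le_one hm']
      linarith
    have hxb : x = ∑ j, b j • residueVertex m a j := by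
      rw [Fin.sum_univ_castSucc]
      ext k
      simp only [hb, Fin.snoc_last, Fin.snoc_castSucc, residueVertex, apex, Fin.lastCases_last,
        Fin.lastCases_castSucc, Pi.add_apply, Finset.sum_apply, Pi.smul_apply, smul_eq_mul]
      cases k using Fin.lastCases with
      | last =>
        simp
        field_simp
      | cast k =>
        simp [Pi.single_apply]
        field_simp
        ring
    have h0 : (0 : Fin (n + 1) → ℝ) ∈ residueSimplex m a :=
      subset_convexHull ℝ _ (by simp)
    have hv : ∀ j, residueVertex m a j ∈ residueSimplex m a := fun j =>
      subset_convexHull ℝ _ (by simp)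
    have hc : Convex ℝ (residueSimplex m a) := convex_convexHull ℝ _
    have := hc.sum_mem (t := (Finset.univ : Finset (Option (Fin (n + 1)))))
      (w := fun o => o.elim (1 - ∑ j, b j) b) (z := fun o => o.elim 0 (residueVertex m a))
      (fun o _ => by cases o <;> simp [hb0, hb1])
      (by simp [Fintype.sum_option])
      (fun o _ => by cases o; exacts [h0, hv _])
    simpa only [Fintype.sum_option, Option.elim, smul_zero, zero_add, ← hxb] using this

theorem mem_smul_residueSimplex {n m : ℕ} (hm : 0 < m) (a : Fin n → ℕ) {t : ℝ} (ht : 0 < t)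
    {x : Fin (n + 1) → ℝ} : x ∈ t • residueSimplex m a ↔ x ∈ residueHalfspaces m a t := by
  rw [Set.mem_smul_set_iff_inv_smul_mem₀ ht.ne', residueSimplex_eq hm]
  have key : ∀ i : Fin n, m * (t⁻¹ • x) i.castSucc + a i * (t⁻¹ • x) (Fin.last n) =
      t⁻¹ * (m * x i.castSucc + a i * x (Fin.last n)) := fun i => by
    simp only [Pi.smul_apply, smul_eq_mul]; ring
  have ht' : 0 < t⁻¹ := inv_pos.2 ht
  simp only [residueHalfspaces, Set.mem_ofPred_eq, key]
  rw [← Finset.mul_sum]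
  simp only [Pi.smul_apply, smul_eq_mul, mul_nonneg_iff_of_pos_left ht', ← mul_add, one_mul]
  rw [inv_mul_le_iff₀ ht]

theorem affineSpan_residueSimplex {n m : ℕ} (hm : 0 < m) (a : Fin n → ℕ) :
    affineSpan ℝ (residueSimplex m a) = ⊤ := by
  have hm' : (0 : ℝ) < m := by exact_mod_cast hm
  let U : Set (Fin (n + 1) → ℝ) :=
    {x | 0 < x (Fin.last n) ∧ (∀ i : Fin n, 0 < m * x i.castSucc + a i * x (Fin.last n)) ∧
      ∑ i : Fin n, (m * x i.castSucc + a i * x (Fin.last n)) + x (Fin.last n) < m}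
  have hU : IsOpen U := by
    simp only [U, Set.ofPred_and, Set.ofPred_forall]
    exact (isOpen_lt (by fun_prop) (by fun_prop)).inter
      ((isOpen_iInter_of_finite fun i => isOpen_lt (by fun_prop) (by fun_prop)).inter
        (isOpen_lt (by fun_prop) (by fun_prop)))
  have hne : U.Nonempty := by
    have hd : (0 : ℝ) < m / (n + 2) := by positivity
    refine ⟨Fin.snoc (α := fun _ => ℝ) (fun i => (1 - a i) / (n + 2)) (m / (n + 2)), ?_⟩
    have key : ∀ i : Fin n, (m : ℝ) * ((1 - a i) / (n + 2)) + a i * (m / (n + 2)) =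
      m / (n + 2) := fun i => by ring
    simp only [U, Set.mem_ofPred_eq, Fin.snoc_last, Fin.snoc_castSucc, key]
    refine ⟨hd, fun _ => hd, ?_⟩
    simp only [Finset.sum_const, Finset.card_univ, Fintype.card_fin, nsmul_eq_mul]
    rw [← add_one_mul, ← mul_div_assoc, div_lt_iff₀ (by positivity)]
    nlinarith
  refine top_unique ((hU.affineSpan_eq_top hne).symm.le.trans (affineSpan_mono ℝ ?_))
  rw [residueSimplex_eq hm]
  exact fun x hx => ⟨hx.1.le, fun i => (hx.2.1 i).le, by linarith [hx.2.2]⟩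

/-- The height of the `r`-th box point of the cone over `residueSimplex m a`. -/
def boxHeight {n : ℕ} (m : ℕ) (a : Fin n → ℕ) (r : ℕ) : ℕ :=
  (∑ i, a i * r % m + r + (m - 1)) / m

/-- The lattice point obtained from the `r`-th box point by adding `y j` copies of the `j`-th
nonzero vertex. -/
def boxTranslate {n : ℕ} (m : ℕ) (a : Fin n → ℕ) (r : ℕ) (y : Fin (n + 1) → ℕ) :
    Fin (n + 1) → ℤ :=
  Fin.snoc (α := fun _ => ℤ)
    (fun i => y i.castSucc - a i * y (Fin.last n) - (a i * r / m : ℕ)) (m * y (Fin.last n) + r)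

theorem boxTranslate_facet {n : ℕ} (m : ℕ) (a : Fin n → ℕ) (r : ℕ) (y : Fin (n + 1) → ℕ)
    (i : Fin n) :
    (m : ℝ) * (boxTranslate m a r y i.castSucc : ℝ) + a i * (boxTranslate m a r y (Fin.last n) : ℝ)
      = ((m * y i.castSucc + a i * r % m : ℕ) : ℝ) := by
  have h : ((a i * r : ℕ) : ℝ) = ((m * (a i * r / m) + a i * r % m : ℕ) : ℝ) := by
    rw [Nat.div_add_mod]
  simp only [boxTranslate, Fin.snoc_castSucc, Fin.snoc_last]
  generalize a i * r / m = q at h ⊢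
  push_cast at h ⊢
  linear_combination h

theorem boxHeight_add_le_iff {n m : ℕ} (hm : 0 < m) (a : Fin n → ℕ) (r s t : ℕ) :
    boxHeight m a r + s ≤ t ↔ m * s + (∑ i, a i * r % m + r) ≤ t * m := by
  unfold boxHeight
  generalize ∑ i, a i * r % m + r = u
  rw [← Nat.add_mul_div_right _ _ hm, ← Nat.lt_succ_iff, Nat.div_lt_iff_lt_mul hm, Nat.succ_mul,
    mul_comm s]
  lia

theorem boxTranslate_mem_iff {n m : ℕ} (hm : 0 < m) (a : Fin n → ℕ) (r t : ℕ)
    (y : Fin (n + 1) → ℕ) :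
    (fun j => (boxTranslate m a r y j : ℝ)) ∈ residueHalfspaces m a t ↔
      y ∈ boundedTuples (n + 1) (boxHeight m a r) t := by
  have hlast : (boxTranslate m a r y (Fin.last n) : ℝ) = ((m * y (Fin.last n) + r : ℕ) : ℝ) := by
    simp [boxTranslate]
  rw [mem_boundedTuples, boxHeight_add_le_iff hm]
  simp only [residueHalfspaces, Set.mem_ofPred_eq, boxTranslate_facet]
  rw [hlast]
  simp only [Nat.cast_nonneg, implies_true, true_and]
  rw [← Nat.cast_sum, ← Nat.cast_add, ← Nat.cast_mul, Nat.cast_le, Fin.sum_univ_castSucc,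
    Finset.sum_add_distrib, ← Finset.mul_sum]
  rw [show m * (∑ i : Fin n, y i.castSucc + y (Fin.last n)) + (∑ i, a i * r % m + r) =
    m * ∑ i : Fin n, y i.castSucc + ∑ i, a i * r % m + (m * y (Fin.last n) + r) by ring]

theorem exists_boxTranslate {n m : ℕ} (hm : 0 < m) (a : Fin n → ℕ) {t : ℝ}
    {z : Fin (n + 1) → ℤ} (hz : (fun j => (z j : ℝ)) ∈ residueHalfspaces m a t) :
    ∃ r < m, ∃ y, boxTranslate m a r y = z := by
  obtain ⟨h0, h1, -⟩ := hz
  beta_reduce at h0 h1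
  have h0' : 0 ≤ z (Fin.last n) := by exact_mod_cast h0
  have h1' : ∀ i : Fin n, 0 ≤ m * z i.castSucc + a i * z (Fin.last n) := fun i => by
    exact_mod_cast h1 i
  have hm' : (m : ℤ) ≠ 0 := by exact_mod_cast hm.ne'
  obtain ⟨w, hw⟩ := Int.eq_ofNat_of_zero_le h0'
  refine ⟨w % m, Nat.mod_lt _ hm, Fin.snoc (α := fun _ => ℕ)
    (fun i => ((m * z i.castSucc + a i * z (Fin.last n)) / m).toNat) (w / m), ?_⟩
  have hdm : (w : ℤ) = m * ((w / m : ℕ) : ℤ) + ((w % m : ℕ) : ℤ) := by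
    exact_mod_cast (Nat.div_add_mod w m).symm
  ext j
  cases j using Fin.lastCases with
  | last => simp only [boxTranslate, Fin.snoc_last]; rw [hw]; exact hdm.symm
  | cast i =>
    simp only [boxTranslate, Fin.snoc_last, Fin.snoc_castSucc]
    rw [Int.toNat_of_nonneg (Int.ediv_nonneg (h1' i) (by positivity)), hw,
      show (m : ℤ) * z i.castSucc + a i * (w : ℤ) =
        ((a i * (w % m) : ℕ) : ℤ) + (z i.castSucc + a i * ((w / m : ℕ) : ℤ)) * m by
          rw [hdm]; push_cast; ring,
      Int.add_mul_ediv_right _ _ hm', Int.natCast_div (a i * (w % m)) m]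
    ring

theorem boxTranslate_injective {n m : ℕ} (a : Fin n → ℕ) {r r' : ℕ} (hr : r < m) (hr' : r' < m)
    {y y' : Fin (n + 1) → ℕ} (h : boxTranslate m a r y = boxTranslate m a r' y') :
    r = r' ∧ y = y' := by
  have hl := congrFun h (Fin.last n)
  simp only [boxTranslate, Fin.snoc_last] at hl
  have hl' : m * y (Fin.last n) + r = m * y' (Fin.last n) + r' := by exact_mod_cast hl
  have hrr : r = r' := by
    have := congrArg (· % m) hl'
    simpa [Nat.mod_eq_of_lt hr, Nat.mod_eq_of_lt hr'] using this
  subst hrr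
  have hy : y (Fin.last n) = y' (Fin.last n) :=
    Nat.eq_of_mul_eq_mul_left (Nat.zero_lt_of_lt hr) (Nat.add_right_cancel hl')
  refine ⟨rfl, funext fun j => ?_⟩
  cases j using Fin.lastCases with
  | last => exact hy
  | cast i =>
    have hi := congrFun h i.castSucc
    simp only [boxTranslate, Fin.snoc_castSucc, hy] at hi
    lia

theorem latticeCount_residueSimplex {n m t : ℕ} (hm : 0 < m) (a : Fin n → ℕ) (ht : 0 < t) :
    latticeCount (residueSimplex m a) t =
      ∑ r ∈ Finset.range m, shiftedChoose (n + 1) t (boxHeight m a r) := by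
  have ht' : (0 : ℝ) < t := by exact_mod_cast ht
  have himage : {x : Fin (n + 1) → ℝ | x ∈ (t : ℝ) • residueSimplex m a ∧
      ∀ i, ∃ z : ℤ, x i = (z : ℝ)} =
      (fun (p : Σ _ : ℕ, Fin (n + 1) → ℕ) j => (boxTranslate m a p.1 p.2 j : ℝ)) ''
        ((Finset.range m).sigma fun r => boundedTuples (n + 1) (boxHeight m a r) t :
          Finset (Σ _ : ℕ, Fin (n + 1) → ℕ)) := by
    ext x
    simp only [Set.mem_ofPred_eq, Set.mem_image, Finset.mem_coe, Finset.mem_sigma,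
      Finset.mem_range, mem_smul_residueSimplex hm a ht']
    constructor
    · rintro ⟨hx, hz⟩
      choose z hz using hz
      obtain rfl : x = fun j => (z j : ℝ) := funext hz
      obtain ⟨r, hr, y, rfl⟩ := exists_boxTranslate hm a hx
      exact ⟨⟨r, y⟩, ⟨hr, (boxTranslate_mem_iff hm a r t y).1 hx⟩, rfl⟩
    · rintro ⟨⟨r, y⟩, ⟨-, hy⟩, rfl⟩
      exact ⟨(boxTranslate_mem_iff hm a r t y).2 hy, fun i => ⟨_, rfl⟩⟩
  rw [latticeCount, himage, Set.InjOn.ncard_image, Set.ncard_coe_finset, Finset.card_sigma]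
  · simp only [card_boundedTuples]
  · rintro ⟨r, y⟩ hp ⟨r', y'⟩ hp' h
    simp only [Finset.mem_coe, Finset.mem_sigma, Finset.mem_range] at hp hp'
    have h' : boxTranslate m a r y = boxTranslate m a r' y' :=
      funext fun j => Int.cast_injective (congrFun h j)
    obtain ⟨rfl, rfl⟩ := boxTranslate_injective a hp.1 hp'.1 h'
    rfl

/-- `f n`, arranged so that kernel reduction evaluates `n` to a numeral first. This and the
functions below are written with recursors and primitive operations on `ℕ`, which the kernel
evaluates quickly. -/
def strictApply {α : Type*} (n : ℕ) (f : ℕ → α) : α :=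
  Nat.rec (f 0) (fun k _ => f k.succ) n

theorem strictApply_eq {α : Type*} (n : ℕ) (f : ℕ → α) : strictApply n f = f n := by
  cases n <;> rfl

/-- The pairing `∑ k, l[k] * w k`. -/
def weightedSum {R : Type*} [Semiring R] : List ℕ → (ℕ → R) → R
  | [], _ => 0
  | c :: l, w => c * w 0 + weightedSum l fun k => w (k + 1)

/-- Pass to `f` the list `l` with its `k`-th entry increased by `c`. -/
def addEntry : List ℕ → ℕ → ℕ → (List ℕ → List ℕ) → List ℕ
  | [], 0, c, f => f [c]
  | [], k + 1, c, f => addEntry [] k c fun l => f (0 :: l)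
  | x :: l, 0, c, f => strictApply (x + c) fun v => f (v :: l)
  | x :: l, k + 1, c, f => addEntry l k c fun l' => f (x :: l')

theorem addEntry_eq (l : List ℕ) (k c : ℕ) (f : List ℕ → List ℕ) :
    addEntry l k c f = f (addEntry l k c id) := by
  induction k generalizing l f with
  | zero => cases l <;> simp [addEntry, strictApply_eq]
  | succ k ih =>
    cases l with
    | nil => simp only [addEntry]; rw [ih, ih [] fun l => id (0 :: l)]; rfl
    | cons x l => simp only [addEntry]; rw [ih, ih l fun l => id (x :: l)]; rfl

theorem weightedSum_addEntry {R : Type*} [Semiring R] (l : List ℕ) (k c : ℕ) (w : ℕ → R) :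
    weightedSum (addEntry l k c id) w = weightedSum l w + c * w k := by
  induction k generalizing l w with
  | zero =>
    cases l with
    | nil => simp [addEntry, weightedSum]
    | cons x l => simp only [addEntry, strictApply_eq, weightedSum, id]; push_cast; noncomm_ring
  | succ k ih =>
    cases l with
    | nil => simp only [addEntry]; rw [addEntry_eq]; simp [weightedSum, ih]
    | cons x l => simp only [addEntry]; rw [addEntry_eq]; simp [weightedSum, ih, add_assoc]

/-- The representative of `d` modulo `m` closest to zero. -/
def signedStep (m d : ℕ) : ℤ := if 2 * d ≤ m then d else d - m

/-- A number of times, at most `bound` unless `d ≠ 0`, that the residue `x` modulo `m` can be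
moved by `signedStep m d` before it wraps around. -/
def residueRun (m d x bound : ℕ) : ℕ :=
  Nat.rec bound (fun d _ =>
    Bool.rec (Nat.div x (Nat.sub m d.succ)).succ (Nat.div (Nat.sub (Nat.pred m) x) d.succ).succ
      (Nat.ble (Nat.mul 2 d.succ) m)) d

/-- A number of steps of size `L` from `r`, at most `bound`, during which no residue
`a * r % m`, `a ∈ A`, wraps around. -/
def runLength (m L r : ℕ) (A : List ℕ) : ℕ → ℕ :=
  List.rec (fun bound => bound) (fun a _ ih bound =>
    strictApply (residueRun m (Nat.mod (Nat.mul a L) m) (Nat.mod (Nat.mul a r) m) bound) fun c =>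
      Bool.rec (ih bound) (ih c) (Nat.ble c bound)) A

/-- The sum of the residues `a * r % m` for `a ∈ A`. -/
def residueSum (m r : ℕ) (A : List ℕ) : ℕ :=
  List.rec 0 (fun a _ ih => Nat.add (Nat.mod (Nat.mul a r) m) ih) A

/-- Add to `acc` the distribution of `residueSum m · A / m` on the first `count` terms of the
progression `r, r + L, …`, run by run. -/
def scanProgression (m L : ℕ) (A : List ℕ) (fuel : ℕ) : ℕ → ℕ → List ℕ → List ℕ :=
  Nat.rec (fun _ _ acc => acc) (fun _ ih r count acc =>
    Nat.rec acc (fun count _ =>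
      strictApply (runLength m L r A count.succ) fun c =>
        addEntry acc (Nat.div (residueSum m r A) m) c fun acc' =>
          strictApply (Nat.add r (Nat.mul c L)) fun r' =>
            strictApply (Nat.sub count.succ c) fun count' => ih r' count' acc') count) fuel

/-- The distribution of `residueSum m · A / m` on the residue classes `0, …, j - 1` modulo `L`
in `0, …, L * q - 1`. -/
def scanClasses (m L q : ℕ) (A : List ℕ) : ℕ → List ℕ
  | 0 => []
  | j + 1 => scanProgression m L A q j q (scanClasses m L q A j)

theorem residueRun_succ (m d x bound : ℕ) :
    residueRun m (d + 1) x bound =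
      if 2 * (d + 1) ≤ m then (m - 1 - x) / (d + 1) + 1 else x / (m - (d + 1)) + 1 := by
  have h0 : residueRun m (d + 1) x bound =
      Bool.rec (x / (m - (d + 1)) + 1) ((m - 1 - x) / (d + 1) + 1) (Nat.ble (2 * (d + 1)) m) := rfl
  rw [h0]
  split_ifs with h
  · rw [Nat.ble_eq_true_of_le h]
  · rw [Bool.eq_false_iff.2 fun h' => h (Nat.le_of_ble_eq_true h')]

theorem residueSum_nil (m r : ℕ) : residueSum m r [] = 0 := rfl

theorem residueSum_cons (m r a : ℕ) (A : List ℕ) :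
    residueSum m r (a :: A) = a * r % m + residueSum m r A := rfl

theorem runLength_cons (m L r a bound : ℕ) (A : List ℕ) :
    runLength m L r (a :: A) bound =
      runLength m L r A (min (residueRun m (a * L % m) (a * r % m) bound) bound) := by
  set c := residueRun m (a * L % m) (a * r % m) bound
  have : runLength m L r (a :: A) bound =
      bif Nat.ble c bound then runLength m L r A c else runLength m L r A bound := by
    have h0 : runLength m L r (a :: A) bound = strictApply c fun c =>
        Bool.rec (runLength m L r A bound) (runLength m L r A c) (Nat.ble c bound) := rfl
    rw [h0, strictApply_eq]
    cases Nat.ble c bound <;> rfl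
  rw [this]
  rcases le_total c bound with h | h
  · rw [Nat.ble_eq_true_of_le h, cond_true, min_eq_left h]
  · cases h' : Nat.ble c bound
    · rw [cond_false, min_eq_right h]
    · rw [cond_true, min_eq_left (Nat.le_of_ble_eq_true h')]

theorem scanProgression_succ (m L : ℕ) (A : List ℕ) (fuel r count : ℕ) (acc : List ℕ) :
    scanProgression m L A (fuel + 1) r (count + 1) acc =
      scanProgression m L A fuel (r + runLength m L r A (count + 1) * L)
        (count + 1 - runLength m L r A (count + 1))
        (addEntry acc (residueSum m r A / m) (runLength m L r A (count + 1)) id) := by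
  have h0 : scanProgression m L A (fuel + 1) r (count + 1) acc =
      strictApply (runLength m L r A (count + 1)) fun c =>
        addEntry acc (residueSum m r A / m) c fun acc' =>
          strictApply (r + c * L) fun r' =>
            strictApply (count + 1 - c) fun count' => scanProgression m L A fuel r' count' acc' :=
    rfl
  simp only [h0, strictApply_eq]
  rw [addEntry_eq]

theorem residueRun_spec {m d x bound j : ℕ} (hd : d < m) (hx : x < m)
    (hj : j < residueRun m d x bound) :
    0 ≤ x + j * signedStep m d ∧ x + j * signedStep m d < m := by
  unfold signedStep
  match d, hj with
  | 0, _ => simp [hx]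
  | d + 1, hj =>
    rw [residueRun_succ] at hj
    split_ifs at hj ⊢ with h
    · rw [Nat.lt_succ_iff, Nat.le_div_iff_mul_le d.succ_pos] at hj
      have : x + j * (d + 1) < m := by
        simp only [Nat.succ_eq_add_one] at hj
        lia
      constructor
      · positivity
      · exact_mod_cast this
    · rw [Nat.lt_succ_iff, Nat.le_div_iff_mul_le (Nat.sub_pos_of_lt hd)] at hj
      obtain ⟨e, rfl⟩ := Nat.exists_eq_add_of_lt hd
      have he : d + 1 + e + 1 - (d + 1) = e + 1 := by lia
      rw [he] at hj
      have : ((d + 1 : ℕ) : ℤ) - ((d + 1 + e + 1 : ℕ) : ℤ) = -((e + 1 : ℕ) : ℤ) := by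
        push_cast; ring
      rw [this]
      zify at hj hx ⊢
      have h0 : (0 : ℤ) ≤ j * (e + 1) := by positivity
      constructor <;> linarith

theorem mul_add_mod_eq_add_signedStep {m L r a bound j : ℕ} (hm : 0 < m)
    (hj : j < residueRun m (a * L % m) (a * r % m) bound) :
    ((a * (r + j * L) % m : ℕ) : ℤ) = (a * r % m : ℕ) + j * signedStep m (a * L % m) := by
  obtain ⟨h0, h1⟩ := residueRun_spec (Nat.mod_lt _ hm) (Nat.mod_lt _ hm) hj
  rw [← Int.emod_eq_of_lt h0 h1, Int.natCast_mod]
  refine Int.ModEq.symm ?_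
  have hs : signedStep m (a * L % m) ≡ a * L [ZMOD m] := by
    have h2 : ((a * L % m : ℕ) : ℤ) ≡ a * L [ZMOD m] := by
      rw [Int.natCast_mod]; push_cast; exact Int.mod_modEq _ _
    unfold signedStep
    split_ifs
    · exact h2
    · simpa using h2.sub (show (m : ℤ) ≡ 0 [ZMOD m] by simp)
  have h3 : ((a * r % m : ℕ) : ℤ) ≡ a * r [ZMOD m] := by
    rw [Int.natCast_mod]; push_cast; exact Int.mod_modEq _ _
  have := h3.add (hs.mul_left j)
  push_cast at this ⊢
  convert this using 1
  ring

theorem runLength_pos {m L r bound : ℕ} (hb : 0 < bound) (A : List ℕ) :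
    0 < runLength m L r A bound := by
  induction A generalizing bound with
  | nil => exact hb
  | cons a A ih =>
    rw [runLength_cons]
    refine ih (lt_min ?_ hb)
    cases a * L % m with
    | zero => exact hb
    | succ d => rw [residueRun_succ]; split_ifs <;> exact Nat.succ_pos _

theorem runLength_le {m L r bound : ℕ} (A : List ℕ) : runLength m L r A bound ≤ bound := by
  induction A generalizing bound with
  | nil => exact le_rfl
  | cons a A ih => rw [runLength_cons]; exact ih.trans (min_le_right _ _)

theorem residueSum_add {m L r bound j : ℕ} (hm : 0 < m) (A : List ℕ)
    (hj : j < runLength m L r A bound) :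
    (residueSum m (r + j * L) A : ℤ) =
      residueSum m r A + j * (A.map fun a => signedStep m (a * L % m)).sum := by
  induction A generalizing bound with
  | nil => simp [residueSum_nil]
  | cons a A ih =>
    rw [runLength_cons] at hj
    have hj' := (hj.trans_le (runLength_le A)).trans_le (min_le_left _ _)
    simp only [residueSum_cons, Nat.cast_add, List.map_cons, List.sum_cons,
      mul_add_mod_eq_add_signedStep hm hj', ih hj]
    ring

theorem weightedSum_scanProgression {R : Type*} [Semiring R] {m L : ℕ} (hm : 0 < m) {A : List ℕ}
    (hA : (A.map fun a => signedStep m (a * L % m)).sum = 0) (w : ℕ → R) {fuel count : ℕ}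
    (hf : count ≤ fuel) (r : ℕ) (acc : List ℕ) :
    weightedSum (scanProgression m L A fuel r count acc) w =
      weightedSum acc w + ∑ j ∈ Finset.range count, w (residueSum m (r + j * L) A / m) := by
  induction fuel generalizing count r acc with
  | zero =>
    obtain rfl : count = 0 := by lia
    simp [scanProgression]
  | succ fuel ih =>
    match count, hf with
    | 0, _ => simp [scanProgression]
    | count + 1, hf =>
      rw [scanProgression_succ]
      set c := runLength m L r A (count + 1)
      have hc0 : 0 < c := runLength_pos count.succ_pos A
      have hc1 : c ≤ count + 1 := runLength_le A
      rw [ih (by lia), weightedSum_addEntry, add_assoc]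
      congr 1
      obtain ⟨e, he⟩ := Nat.exists_eq_add_of_le hc1
      rw [he, Nat.add_sub_cancel_left, Finset.sum_range_add]
      congr 1
      · rw [Finset.sum_congr rfl (g := fun _ => w (residueSum m r A / m)), Finset.sum_const,
          Finset.card_range, nsmul_eq_mul]
        intro j hj
        have := residueSum_add hm A (Finset.mem_range.1 hj)
        rw [hA, mul_zero, add_zero] at this
        rw [Int.natCast_inj.1 this]
      · refine Finset.sum_congr rfl fun j _ => ?_
        rw [add_mul, add_assoc]

theorem sum_range_mul_eq_sum_classes {R : Type*} [AddCommMonoid R] (L q : ℕ) (f : ℕ → R) :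
    ∑ r ∈ Finset.range (L * q), f r =
      ∑ i ∈ Finset.range L, ∑ j ∈ Finset.range q, f (i + j * L) := by
  induction q with
  | zero => simp
  | succ q ih =>
    simp only [Finset.sum_range_succ, Finset.sum_add_distrib, ← ih, Nat.mul_succ,
      Finset.sum_range_add]
    congr 1
    exact Finset.sum_congr rfl fun i _ => by rw [add_comm, mul_comm]

theorem weightedSum_scanClasses {R : Type*} [Semiring R] {m L q : ℕ} (hm : 0 < m) {A : List ℕ}
    (hA : (A.map fun a => signedStep m (a * L % m)).sum = 0) (w : ℕ → R) :
    weightedSum (scanClasses m L q A L) w =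
      ∑ r ∈ Finset.range (L * q), w (residueSum m r A / m) := by
  rw [sum_range_mul_eq_sum_classes]
  suffices ∀ i, weightedSum (scanClasses m L q A i) w =
      ∑ i ∈ Finset.range i, ∑ j ∈ Finset.range q, w (residueSum m (i + j * L) A / m) from this L
  intro i
  induction i with
  | zero => simp [scanClasses, weightedSum]
  | succ i ih =>
    rw [scanClasses, weightedSum_scanProgression hm hA w le_rfl, ih, Finset.sum_range_succ]

/-- The integer polynomial with the given coefficients, lowest first, evaluated at `x`. -/
def evalCoeffs (x : ℚ) : List ℤ → ℚ
  | [] => 0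
  | c :: l => c + x * evalCoeffs x l

/-- The coefficients of `c + (X + s) * l`. -/
def mulLinear (s : ℤ) : ℤ → List ℤ → List ℤ
  | c, [] => [c]
  | c, x :: l => (c + s * x) :: mulLinear s x l

/-- The coefficients of `c * g + l`. -/
def mulAdd (c : ℤ) : List ℤ → List ℤ → List ℤ
  | [], l => l
  | x :: g, [] => c * x :: mulAdd c g []
  | x :: g, y :: l => (c * x + y) :: mulAdd c g l

/-- The coefficients of `∏ j ∈ range i, (X + j + 1 - k)`. -/
def shiftedProdCoeffs (k : ℕ) : ℕ → List ℤ
  | 0 => [1]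
  | j + 1 => mulLinear (j + 1 - k) 0 (shiftedProdCoeffs k j)

/-- The coefficients of `n!` times the Ehrhart polynomial of an `n`-dimensional polytope whose
`h*`-vector, preceded by `k` zeros, is the given list. -/
def ehrhartCoeffs (n : ℕ) : ℕ → List ℕ → List ℤ
  | _, [] => []
  | k, c :: h => mulAdd c (shiftedProdCoeffs k n) (ehrhartCoeffs n (k + 1) h)

theorem evalCoeffs_mulLinear (x : ℚ) (s c : ℤ) (l : List ℤ) :
    evalCoeffs x (mulLinear s c l) = c + (x + s) * evalCoeffs x l := by
  induction l generalizing c with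
  | nil => simp [mulLinear, evalCoeffs]
  | cons a l ih => simp only [mulLinear, evalCoeffs, ih]; push_cast; ring

theorem evalCoeffs_mulAdd (x : ℚ) (c : ℤ) (g l : List ℤ) :
    evalCoeffs x (mulAdd c g l) = c * evalCoeffs x g + evalCoeffs x l := by
  induction g generalizing l with
  | nil => simp [mulAdd, evalCoeffs]
  | cons a g ih =>
    cases l <;> simp only [mulAdd, evalCoeffs, ih] <;> push_cast <;> ring

theorem evalCoeffs_shiftedProdCoeffs (x : ℚ) (k n : ℕ) :
    evalCoeffs x (shiftedProdCoeffs k n) = ∏ j ∈ Finset.range n, (x + j + 1 - k) := by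
  induction n with
  | zero => simp [shiftedProdCoeffs, evalCoeffs]
  | succ n ih =>
    rw [shiftedProdCoeffs, evalCoeffs_mulLinear, ih, Finset.prod_range_succ]
    push_cast; ring

theorem prod_eq_factorial_mul_shiftedChoose {n k : ℕ} (hk : k ≤ n) (t : ℕ) :
    ∏ j ∈ Finset.range n, ((t : ℚ) + j + 1 - k) = n.factorial * shiftedChoose n t k := by
  unfold shiftedChoose
  split_ifs with h
  · obtain ⟨s, rfl⟩ := Nat.exists_eq_add_of_le h
    have := Nat.ascFactorial_eq_factorial_mul_choose s n
    rw [Nat.ascFactorial_eq_prod_range] at this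
    rw [Nat.add_sub_cancel_left, ← Nat.cast_mul, ← this, Nat.cast_prod]
    refine Finset.prod_congr rfl fun j _ => ?_
    push_cast; ring
  · rw [Nat.cast_zero, mul_zero]
    refine Finset.prod_eq_zero (i := k - 1 - t) (Finset.mem_range.2 (by lia)) ?_
    rw [Nat.cast_sub (by lia), Nat.cast_sub (by lia)]
    push_cast; ring

theorem evalCoeffs_ehrhartCoeffs {n k : ℕ} {h : List ℕ} (hk : k + h.length ≤ n + 1) (t : ℕ) :
    evalCoeffs t (ehrhartCoeffs n k h) =
      n.factorial * weightedSum h fun j => (shiftedChoose n t (k + j) : ℚ) := by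
  induction h generalizing k with
  | nil => simp [ehrhartCoeffs, evalCoeffs, weightedSum]
  | cons c h ih =>
    rw [List.length_cons] at hk
    rw [ehrhartCoeffs, evalCoeffs_mulAdd, evalCoeffs_shiftedProdCoeffs,
      prod_eq_factorial_mul_shiftedChoose (by lia), ih (by lia), weightedSum]
    simp only [add_zero, Int.cast_natCast, add_assoc, add_comm 1]
    ring

/-- The polynomial with the given coefficients, lowest first. -/
noncomputable def polynomialOfCoeffs : List ℤ → Polynomial ℚ
  | [] => 0
  | c :: l => Polynomial.C (c : ℚ) + Polynomial.X * polynomialOfCoeffs l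

theorem eval_polynomialOfCoeffs (x : ℚ) (l : List ℤ) :
    (polynomialOfCoeffs l).eval x = evalCoeffs x l := by
  induction l with
  | nil => simp [polynomialOfCoeffs, evalCoeffs]
  | cons c l ih => simp [polynomialOfCoeffs, evalCoeffs, ih]

theorem coeff_polynomialOfCoeffs (l : List ℤ) (i : ℕ) :
    (polynomialOfCoeffs l).coeff i = (l.getD i 0 : ℤ) := by
  induction l generalizing i with
  | nil => simp [polynomialOfCoeffs]
  | cons c l ih =>
    cases i <;> simp only [polynomialOfCoeffs, Polynomial.coeff_add, Polynomial.coeff_C_zero,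
      Polynomial.coeff_C_succ, Polynomial.coeff_X_mul, Polynomial.coeff_X_mul_zero, ih,
      List.getD_cons_zero, List.getD_cons_succ, add_zero, zero_add]

/-- The coordinates of the box points of `residueSimplex`, as multipliers modulo `m`: those in
`l`, that of the apex, and that of the origin. -/
def boxMultipliers (m : ℕ) (l : List ℕ) : List ℕ :=
  l ++ [1, (m - (l.sum + 1) % m) % m]

theorem residueSum_append (m r : ℕ) (l l' : List ℕ) :
    residueSum m r (l ++ l') = residueSum m r l + residueSum m r l' := by
  induction l with
  | nil => simp [residueSum_nil]
  | cons a l ih => simp [residueSum_cons, ih, add_assoc]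

theorem residueSum_modEq (m r : ℕ) (l : List ℕ) : residueSum m r l ≡ l.sum * r [MOD m] := by
  induction l with
  | nil => simp [residueSum_nil, Nat.ModEq]
  | cons a l ih =>
    rw [residueSum_cons, List.sum_cons, add_mul]
    exact (Nat.mod_modEq _ _).add ih

theorem residueSum_eq_sum (m r : ℕ) (l : List ℕ) :
    residueSum m r l = ∑ i : Fin l.length, l.get i * r % m := by
  induction l with
  | nil => simp [residueSum_nil]
  | cons a l ih => simp [residueSum_cons, ih, Fin.sum_univ_succ]

theorem boxHeight_eq {m r : ℕ} (hr : r < m) (l : List ℕ) :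
    boxHeight m l.get r = residueSum m r (boxMultipliers m l) / m := by
  have hm : 0 < m := Nat.zero_lt_of_lt hr
  set e := (m - (l.sum + 1) % m) % m with he
  have hdvd : m ∣ residueSum m r (boxMultipliers m l) := by
    rw [← Nat.modEq_zero_iff_dvd]
    refine (residueSum_modEq _ _ _).trans ?_
    have : (boxMultipliers m l).sum ≡ 0 [MOD m] := by
      simp only [boxMultipliers, List.sum_append, List.sum_cons, List.sum_nil, ← he, add_zero]
      rw [← add_assoc]
      have h1 : e ≡ m - (l.sum + 1) % m [MOD m] := Nat.mod_modEq _ _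
      have h2 := (Nat.mod_modEq (l.sum + 1) m).symm.add h1
      rw [Nat.add_sub_cancel' (Nat.mod_lt _ hm).le] at h2
      exact h2.trans (by simp [Nat.ModEq])
    simpa using this.mul_right r
  obtain ⟨q, hq⟩ := hdvd
  rw [hq, Nat.mul_div_cancel_left _ hm]
  rw [boxMultipliers, residueSum_append] at hq
  simp only [residueSum_cons, residueSum_nil, one_mul, Nat.mod_eq_of_lt hr, add_zero, ← he] at hq
  rw [residueSum_eq_sum] at hq
  have hlt : e * r % m < m := Nat.mod_lt _ hm
  unfold boxHeight
  apply Nat.div_eq_of_lt_le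
  · rw [mul_comm]; lia
  · rw [add_mul, mul_comm]; lia

/-- The scaled Ehrhart coefficients of `residueSimplex m l.get`, computed with stride `L`. -/
def simplexCoeffs (n m L : ℕ) (l : List ℕ) : List ℤ :=
  ehrhartCoeffs n 0 (scanClasses m L (m / L) (boxMultipliers m l) L)

/-- The conditions on `m`, `L` and `l` that make `simplexCoeffs n m L l` correct. -/
def IsAdmissible (n m L : ℕ) (l : List ℕ) : Prop :=
  l.length + 1 = n ∧ 0 < m ∧ L * (m / L) = m ∧
    ((boxMultipliers m l).map fun a => signedStep m (a * L % m)).sum = 0 ∧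
    (scanClasses m L (m / L) (boxMultipliers m l) L).length ≤ n + 1

instance (n m L : ℕ) (l : List ℕ) : Decidable (IsAdmissible n m L l) :=
  inferInstanceAs (Decidable (_ ∧ _))

theorem latticeCount_eq_evalCoeffs {n m L : ℕ} {l : List ℕ} (h : IsAdmissible n m L l) {t : ℕ}
    (ht : 0 < t) :
    (n.factorial * latticeCount (residueSimplex m l.get) t : ℚ) =
      evalCoeffs t (simplexCoeffs n m L l) := by
  obtain ⟨rfl, hm, hL, hA, hlen⟩ := h
  rw [simplexCoeffs, evalCoeffs_ehrhartCoeffs (by simpa using hlen),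
    latticeCount_residueSimplex hm _ ht, weightedSum_scanClasses hm hA, hL]
  congr 1
  push_cast
  refine Finset.sum_congr rfl fun r hr => ?_
  rw [boxHeight_eq (Finset.mem_range.1 hr), zero_add]

/-- The list `c` consists of the coefficients of `n!` times a polynomial of degree `n` with
constant coefficient `1`, negative coefficients in the positive degrees satisfying `neg`, and
positive coefficients in the other positive degrees. -/
def HasSignPattern (n : ℕ) (neg : ℕ → Bool) (c : List ℤ) : Prop :=
  c.length = n + 1 ∧ c.getD 0 0 = n.factorial ∧
    ∀ i < n, bif neg (i + 1) then c.getD (i + 1) 0 < 0 else 0 < c.getD (i + 1) 0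

instance (b : Bool) (p q : Prop) [Decidable p] [Decidable q] : Decidable (bif b then p else q) :=
  match b with
  | true => inferInstanceAs (Decidable p)
  | false => inferInstanceAs (Decidable q)

instance (n : ℕ) (neg : ℕ → Bool) (c : List ℤ) : Decidable (HasSignPattern n neg c) :=
  inferInstanceAs (Decidable (_ ∧ _))

theorem exists_polytope_of_hasSignPattern {n m L : ℕ} {l : List ℕ} {neg : ℕ → Bool} (hn : 0 < n)
    (h : IsAdmissible n m L l) (hs : HasSignPattern n neg (simplexCoeffs n m L l)) :
    ∃ (P : Set (Fin n → ℝ)) (p : Polynomial ℚ),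
      IsIntegralPolytope P ∧ affineSpan ℝ P = ⊤ ∧ p.natDegree = n ∧ p.coeff 0 = 1 ∧
      (∀ t : ℕ, 0 < t → (latticeCount P t : ℚ) = p.eval (t : ℚ)) ∧
      ∀ i ∈ Finset.Icc 1 n, if neg i then p.coeff i < 0 else 0 < p.coeff i := by
  have hcount := fun t => @latticeCount_eq_evalCoeffs n m L l h t
  obtain ⟨rfl, hm, -⟩ := h
  obtain ⟨hlen, h0, hsign⟩ := hs
  set c := simplexCoeffs (l.length + 1) m L l
  set f : ℚ := ((l.length + 1).factorial : ℚ) with hf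
  have hfpos : 0 < f := by positivity
  have hcoeff : ∀ i, (Polynomial.C f⁻¹ * polynomialOfCoeffs c).coeff i =
      f⁻¹ * (c.getD i 0 : ℤ) := fun i => by
    rw [Polynomial.coeff_C_mul, coeff_polynomialOfCoeffs]
  have hsign' : ∀ i ∈ Finset.Icc 1 (l.length + 1),
      if neg i then (Polynomial.C f⁻¹ * polynomialOfCoeffs c).coeff i < 0
        else 0 < (Polynomial.C f⁻¹ * polynomialOfCoeffs c).coeff i := by
    intro i hi
    obtain ⟨hi1, hi2⟩ := Finset.mem_Icc.1 hi
    obtain ⟨j, rfl⟩ := Nat.exists_eq_add_of_le' hi1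
    have := hsign j (by lia)
    rw [hcoeff]
    cases hneg : neg (j + 1) <;> rw [hneg] at this
    · have hc : (0 : ℚ) < (c.getD (j + 1) 0 : ℤ) := by exact_mod_cast this
      simpa using mul_pos (inv_pos.2 hfpos) hc
    · have hc : ((c.getD (j + 1) 0 : ℤ) : ℚ) < 0 := by exact_mod_cast this
      simpa using mul_neg_of_pos_of_neg (inv_pos.2 hfpos) hc
  refine ⟨residueSimplex m l.get, Polynomial.C f⁻¹ * polynomialOfCoeffs c,
    isIntegralPolytope_residueSimplex _ _, affineSpan_residueSimplex hm _, ?_, ?_, fun t ht => ?_,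
    hsign'⟩
  · refine Polynomial.natDegree_eq_of_le_of_coeff_ne_zero ?_ ?_
    · refine Polynomial.natDegree_le_iff_coeff_eq_zero.2 fun i hi => ?_
      rw [hcoeff, List.getD_eq_default _ _ (by lia)]
      simp
    · have := hsign' (l.length + 1) (by simp)
      split_ifs at this
      exacts [this.ne, this.ne']
  · rw [hcoeff, h0, Int.cast_natCast, ← hf, inv_mul_cancel₀ hfpos.ne']
  · rw [Polynomial.eval_mul, Polynomial.eval_C, eval_polynomialOfCoeffs, ← hcount t ht,
      inv_mul_cancel_left₀ (ne_of_gt hfpos)]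

/-- Data for `residueSimplex` in dimension 8: `(m, L, l)` in position `k` gives negative Ehrhart
coefficients in degree `i` for exactly those `i ≤ 8` with bit `i` of `2 * k` set. -/
def simplexTable : List (ℕ × ℕ × List ℕ) := [
  (1130051, 1, [0, 1130050, 0, 0, 0, 0, 0]),
  (1793559, 1, [0, 0, 1793556, 1793557, 0, 0, 0]),
  (421, 1, [0, 0, 0, 0, 420, 1, 1]),
  (315815, 1, [315814, 0, 0, 0, 0, 1, 0]),
  (556, 2, [277, 1, 277, 277, 1, 0, 0]),
  (427005, 5, [1, 1, 1, 1, 256203, 1, 341602]),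
  (1347, 3, [1346, 0, 0, 0, 1346, 449, 898]),
  (553330, 2, [553329, 0, 1, 0, 553329, 0, 276665]),
  (1541005, 1, [1, 1, 1541003, 1, 1, 1541003, 1]),
  (3354, 3, [3, 1117, 1117, 1117, 1117, 2236, 1118]),
  (1640594, 2, [1, 1640591, 1640591, 4, 820298, 1, 820298]),
  (1964760, 3, [3, 654919, 654919, 1309840, 654919, 1309840, 654920]),
  (925825, 1, [0, 0, 1, 925824, 925824, 0, 1]),
  (90056, 4, [67541, 22514, 0, 22514, 90055, 45029, 45029]),
  (396170, 5, [396169, 0, 396169, 1, 0, 158468, 0]),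
  (718224, 3, [239408, 478815, 1, 239407, 239407, 0, 1]),
  (556, 2, [555, 1, 277, 277, 1, 555, 0]),
  (819095, 5, [1, 1, 655275, 1, 655275, 655276, 655275]),
  (2241, 3, [1, 746, 746, 746, 1494, 1, 746]),
  (1010724, 3, [1, 336907, 336907, 336907, 336907, 1, 1]),
  (866175, 5, [1, 1, 692939, 1, 692940, 692940, 692938]),
  (1614360, 30, [6, 914803, 807181, 968616, 1, 968615, 914803]),
  (962451, 3, [320817, 641632, 320817, 320816, 320816, 1, 1]),
  (1848075, 15, [123205, 492821, 0, 1, 1848074, 862435, 1]),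
  (1115, 1, [1, 1114, 1113, 1114, 1, 1, 0]),
  (303267, 3, [0, 303266, 1, 303266, 1, 303266, 101089]),
  (10765, 5, [1, 1, 8612, 1, 8611, 8611, 10763]),
  (627411, 3, [209136, 418274, 627408, 209136, 209136, 1, 1]),
  (1351620, 1, [0, 1, 1, 1351619, 1351619, 0, 1]),
  (180036, 6, [2, 2, 90018, 120024, 180034, 180032, 0]),
  (1625290, 5, [1, 1, 1300232, 1, 1300231, 1300231, 1625288]),
  (1106648, 8, [553323, 553323, 553325, 1106646, 553323, 414994, 0]),
  (1115, 1, [1, 1, 1113, 1114, 1, 2, 1114]),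
  (45315, 3, [15111, 45314, 15105, 45314, 3, 3, 45314]),
  (776414, 1, [1, 776413, 776413, 776413, 1, 1, 1]),
  (237435, 15, [237434, 237434, 126632, 79145, 221606, 110803, 1]),
  (2155, 5, [2154, 1, 2154, 1724, 2154, 1, 1724]),
  (95085, 5, [1, 57048, 1, 95084, 95082, 95082, 76068]),
  (1665279, 3, [1, 1110186, 1665278, 1, 1665278, 1, 1665276]),
  (569574, 3, [189858, 569573, 379716, 189857, 3, 3, 569573]),
  (1766766, 1, [1766765, 1766765, 1, 2, 1766765, 2, 2]),
  (101619, 3, [33879, 101618, 67746, 101618, 3, 3, 101618]),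
  (1148528, 2, [574263, 574263, 574265, 1148526, 574263, 11, 7]),
  (1608056, 4, [402014, 402025, 3, 1206047, 402010, 1608054, 1608050]),
  (1171165, 5, [1171164, 1, 1171164, 936932, 1171164, 1, 936932]),
  (1557165, 5, [1, 934296, 1, 1557164, 7, 1557162, 622866]),
  (1749528, 4, [437382, 437393, 1749526, 874763, 437378, 874765, 1749522]),
  (1328415, 15, [88561, 885611, 531369, 1328413, 1328413, 619927, 1]),
  (375, 1, [1, 374, 1, 1, 374, 374, 374]),
  (1115, 1, [0, 1, 1, 1114, 1114, 1, 1114]),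
  (10780, 5, [1, 2156, 10779, 8624, 1, 10779, 10778]),
  (776414, 1, [1, 776413, 776413, 776413, 1, 1, 0]),
  (1143921, 3, [1, 1143920, 381307, 1143919, 1, 1143920, 762614]),
  (915240, 24, [457619, 686428, 1, 495754, 915239, 305080, 1]),
  (141280, 8, [1, 52980, 141279, 141279, 1, 52980, 141279]),
  (830128, 4, [207531, 9, 415059, 415064, 830125, 2, 830123]),
  (2241, 3, [1, 746, 747, 746, 2240, 1, 1]),
  (1402200, 5, [1, 1402199, 1402199, 1, 280440, 1121760, 0]),
  (1368544, 4, [342136, 342147, 1, 1368543, 342128, 684272, 1026411]),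
  (1633446, 2, [1633444, 0, 1633439, 1633444, 7, 816729, 7]),
  (835066, 2, [835065, 835063, 835063, 4, 835065, 1, 417533]),
  (1180216, 4, [295053, 9, 1180211, 590108, 1180213, 590110, 1180211]),
  (1180216, 4, [295054, 9, 1180211, 590108, 5, 590110, 1180211]),
  (1884072, 12, [1884070, 942035, 628031, 1884071, 1884069, 1099045, 942036])]

/-- Every entry of the table, with positions counted from `k`, is admissible and has the sign
pattern encoded by its position. -/
def RealizesPatterns : ℕ → List (ℕ × ℕ × List ℕ) → Prop
  | _, [] => True
  | k, (m, L, l) :: t =>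
    (IsAdmissible 8 m L l ∧ HasSignPattern 8 (Nat.testBit (2 * k)) (simplexCoeffs 8 m L l)) ∧
      RealizesPatterns (k + 1) t

instance decidableRealizesPatterns :
    (k : ℕ) → (t : List (ℕ × ℕ × List ℕ)) → Decidable (RealizesPatterns k t)
  | _, [] => inferInstanceAs (Decidable True)
  | k, (_, _, _) :: t =>
    have := decidableRealizesPatterns (k + 1) t
    inferInstanceAs (Decidable (_ ∧ _))

theorem RealizesPatterns.exists {t : List (ℕ × ℕ × List ℕ)} {k j : ℕ} (h : RealizesPatterns k t)
    (hj : j < t.length) :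
    ∃ m L l, IsAdmissible 8 m L l ∧
      HasSignPattern 8 (Nat.testBit (2 * (k + j))) (simplexCoeffs 8 m L l) := by
  induction t generalizing k j with
  | nil => simp at hj
  | cons d t ih =>
    obtain ⟨m, L, l⟩ := d
    cases j with
    | zero => exact ⟨m, L, l, h.1⟩
    | succ j =>
      rw [← add_assoc, add_right_comm]
      exact ih h.2 (by simpa using hj)

theorem realizesPatterns_simplexTable : RealizesPatterns 0 simplexTable := by decide +kernel

theorem exists_testBit_eq_mem :
    ∀ S ∈ (Finset.Icc 1 6).powerset, ∃ k < simplexTable.length,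
      ∀ i ∈ Finset.Icc 1 8, Nat.testBit (2 * k) i = decide (i ∈ S) := by
  decide +kernel

/-- Every sign pattern of the middle Ehrhart coefficients is realized in
dimension 8. -/
theorem sign_pattern_dim_8 (S : Finset ℕ) (hS : S ⊆ Finset.Icc 1 6) :
    ∃ (P : Set (Fin 8 → ℝ)) (p : Polynomial ℚ),
      IsIntegralPolytope P ∧ affineSpan ℝ P = ⊤ ∧
      p.natDegree = 8 ∧ p.coeff 0 = 1 ∧
      (∀ t : ℕ, 0 < t → (latticeCount P t : ℚ) = p.eval (t : ℚ)) ∧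
      (∀ i ∈ S, p.coeff i < 0) ∧
      (∀ i ∈ Finset.Icc 1 8, i ∉ S → 0 < p.coeff i) := by
  obtain ⟨k, hk, hbit⟩ := exists_testBit_eq_mem S (Finset.mem_powerset.2 hS)
  obtain ⟨m, L, l, had, hsign⟩ := realizesPatterns_simplexTable.exists hk
  rw [zero_add] at hsign
  obtain ⟨P, p, hP, hspan, hdeg, h0, hcount, hcoeff⟩ :=
    exists_polytope_of_hasSignPattern (by norm_num) had hsign
  refine ⟨P, p, hP, hspan, hdeg, h0, hcount, fun i hi => ?_, fun i hi hiS => ?_⟩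
  · have hi8 := Finset.Icc_subset_Icc_right (by norm_num : 6 ≤ 8) (hS hi)
    simpa [hbit i hi8, hi] using hcoeff i hi8
  · simpa [hbit i hi, hiS] using hcoeff i hi
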